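/- arXiv:1812.07529 — 2 statements merged into one kernel-verified Lean document; each statement's English description precedes it below -/
import Mathlib

section
/- Let g : ℝ → ℝ be continuous and fix s ∈ ℝ. For a ∈ ℝ define F_a(x) = ∫_a^x (y − a) g(y) dy, and let E(s) = { a ∈ ℝ : F_a(s) ≤ F_a(x) for all x ∈ ℝ } be the set of levels a for which F_a attains a global minimum at s. Then E(s) is convex: if a₁, a₂ ∈ E(s) and λ ∈ [0,1], then λ a₁ + (1 − λ) a₂ ∈ E(s). -/
/-- The increment of `x ↦ ∫_a^x (y-a) g(y) dy` is an affine function of `a`. -/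
theorem integral_sub_mul_increment {g : ℝ → ℝ} (hg : Continuous g) (a s x : ℝ) :
    (∫ y in a..x, (y - a) * g y) - ∫ y in a..s, (y - a) * g y
      = (∫ y in s..x, y * g y) - a * ∫ y in s..x, g y := by
  have hc : Continuous fun y => (y - a) * g y := by fun_prop
  have hid : Continuous fun y => y * g y := by fun_prop
  have hconst : Continuous fun y => a * g y := by fun_prop
  rw [intervalIntegral.integral_interval_sub_left (hc.intervalIntegrable _ _)
    (hc.intervalIntegrable _ _), ← intervalIntegral.integral_const_mul,
    ← intervalIntegral.integral_sub (hid.intervalIntegrable _ _) (hconst.intervalIntegrable _ _)]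
  simp only [sub_mul]

/-- For continuous `g` and `F_a(x) = ∫_a^x (y-a) g(y) dy`, the set
`E(s)` of levels `a` at which `F_a` attains a global minimum at `s` is convex. -/
theorem stmt9 (g : ℝ → ℝ) (hg : Continuous g) (s : ℝ)
    (F : ℝ → ℝ → ℝ) (hF : ∀ a x : ℝ, F a x = ∫ y in a..x, (y - a) * g y)
    (E : Set ℝ) (hE : E = {a : ℝ | ∀ x : ℝ, F a s ≤ F a x})
    (a₁ a₂ : ℝ) (h₁ : a₁ ∈ E) (h₂ : a₂ ∈ E)
    (l : ℝ) (hl : l ∈ Set.Icc (0:ℝ) 1) :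
    l * a₁ + (1 - l) * a₂ ∈ E := by
  subst hE
  obtain ⟨hl₀, hl₁⟩ := hl
  intro x
  have hinc (a : ℝ) : F a x - F a s = (∫ y in s..x, y * g y) - a * ∫ y in s..x, g y := by
    rw [hF, hF, integral_sub_mul_increment hg]
  have hnonneg₁ := mul_nonneg hl₀ (sub_nonneg.2 (h₁ x))
  have hnonneg₂ := mul_nonneg (sub_nonneg.2 hl₁) (sub_nonneg.2 (h₂ x))
  rw [hinc] at hnonneg₁ hnonneg₂
  rw [← sub_nonneg, hinc]
  linarith
end

section
/- Let g : ℝ → ℝ be continuous and fix s ∈ ℝ. For a ∈ ℝ define F_a(x) = ∫_a^x (y − a) g(y) dy, and let E(s) = { a ∈ ℝ : F_a(s) ≤ F_a(x) for all x ∈ ℝ }. Suppose s ∈ E(s) and E(s) ≠ {s}. Then g(y) = 0 for every y ∈ E(s). -/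
open Set Filter Topology in
/-- If both `∫₀ᵗ u h(u) du` and `∫₀ᵗ (u - 1) h(u) du` are nonnegative for all `t`, then the
continuous function `h` vanishes on `[0, 1]`. -/
lemma eqOn_zero_Icc_of_integral_mul_nonneg {h : ℝ → ℝ} (hh : Continuous h)
    (h0 : ∀ t : ℝ, 0 ≤ ∫ u in (0 : ℝ)..t, u * h u)
    (h1 : ∀ t : ℝ, 0 ≤ ∫ u in (0 : ℝ)..t, (u - 1) * h u) :
    EqOn h 0 (Icc 0 1) := by
  have hc : Continuous fun u : ℝ => u * h u := by fun_prop
  set G : ℝ → ℝ := fun t => ∫ u in (0 : ℝ)..t, h u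
  set A : ℝ → ℝ := fun t => ∫ u in (0 : ℝ)..t, u * h u
  have hG : ∀ t, HasDerivAt G (h t) t := fun t => hh.integral_hasStrictDerivAt 0 t |>.hasDerivAt
  have hA : ∀ t, HasDerivAt A (t * h t) t :=
    fun t => hc.integral_hasStrictDerivAt 0 t |>.hasDerivAt
  have hG0 : G 0 = 0 := intervalIntegral.integral_same
  have hA0 : A 0 = 0 := intervalIntegral.integral_same
  have hGA : ∀ t, G t ≤ A t := by
    intro t
    have e : ∫ u in (0 : ℝ)..t, (u - 1) * h u = A t - G t := by
      simp only [sub_mul, one_mul]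
      exact intervalIntegral.integral_sub (hc.intervalIntegrable _ _)
        (hh.intervalIntegrable _ _)
    linarith [h1 t]
  set q : ℝ → ℝ := fun t => G t - t⁻¹ * A t
  have hq : ∀ t, 0 < t → HasDerivAt q (A t / t ^ 2) t := by
    intro t ht
    refine ((hG t).fun_sub ((hasDerivAt_inv ht.ne').fun_mul (hA t))).congr_deriv ?_
    field_simp
    ring
  have hmono : MonotoneOn q (Ioo 0 1) := by
    refine monotoneOn_of_deriv_nonneg (convex_Ioo 0 1)
      (fun t ht => (hq t ht.1).continuousAt.continuousWithinAt) ?_ ?_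
    · intro t ht
      rw [interior_Ioo] at ht
      exact (hq t ht.1).differentiableAt.differentiableWithinAt
    · intro t ht
      rw [interior_Ioo] at ht
      rw [(hq t ht.1).deriv]
      exact div_nonneg (h0 t) (sq_nonneg t)
  have hlim : Tendsto q (𝓝[>] 0) (𝓝 0) := by
    have l1 : Tendsto G (𝓝[>] 0) (𝓝 0) := by
      have := (hG 0).continuousAt.tendsto
      rw [hG0] at this
      exact this.mono_left nhdsWithin_le_nhds
    have l2 : Tendsto (fun t => t⁻¹ * A t) (𝓝[>] 0) (𝓝 0) := by
      simpa [hA0] using (hA 0).tendsto_slope_zero_right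
    simpa using l1.sub l2
  have hq_nonneg : ∀ t ∈ Ioo (0 : ℝ) 1, 0 ≤ q t := by
    intro t ht
    refine le_of_tendsto hlim ?_
    filter_upwards [Ioo_mem_nhdsGT ht.1] with u hu
    exact hmono ⟨hu.1, hu.2.trans ht.2⟩ ht hu.2.le
  have hq_zero : ∀ t ∈ Ioo (0 : ℝ) 1, q t = 0 := by
    intro t ht
    refine le_antisymm ?_ (hq_nonneg t ht)
    have h2 : A t ≤ t⁻¹ * A t := le_mul_of_one_le_left (h0 t) ((one_le_inv₀ ht.1).2 ht.2.le)
    exact sub_nonpos.2 ((hGA t).trans h2)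
  have hA_zero : ∀ t ∈ Ioo (0 : ℝ) 1, A t = 0 := by
    intro t ht
    have e : q =ᶠ[𝓝 t] fun _ => 0 := by
      filter_upwards [Ioo_mem_nhds ht.1 ht.2] with u hu using hq_zero u hu
    have e2 := (hq t ht.1).unique ((hasDerivAt_const t (0 : ℝ)).congr_of_eventuallyEq e)
    simpa [ht.1.ne'] using e2
  have hh_zero : EqOn h 0 (Ioo 0 1) := by
    intro t ht
    have e : A =ᶠ[𝓝 t] fun _ => 0 := by
      filter_upwards [Ioo_mem_nhds ht.1 ht.2] with u hu using hA_zero u hu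
    have e2 := (hA t).unique ((hasDerivAt_const t (0 : ℝ)).congr_of_eventuallyEq e)
    simpa [ht.1.ne'] using e2
  have := hh_zero.closure hh continuous_zero
  rwa [closure_Ioo zero_ne_one] at this

/-- If `∫ₛˣ (y - s) g(y) dy` and `∫ₛˣ (y - a) g(y) dy` are nonnegative for all `x`, where `a ≠ s`,
then the continuous function `g` vanishes at `s` and at `a`. -/
lemma eq_zero_and_eq_zero_of_integral_sub_mul_nonneg {g : ℝ → ℝ} (hg : Continuous g) {s a : ℝ}
    (has : a ≠ s) (h0 : ∀ x : ℝ, 0 ≤ ∫ y in s..x, (y - s) * g y)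
    (h1 : ∀ x : ℝ, 0 ≤ ∫ y in s..x, (y - a) * g y) : g s = 0 ∧ g a = 0 := by
  have hc : a - s ≠ 0 := sub_ne_zero.2 has
  have key (b t : ℝ) : ∫ y in s..(s + (a - s) * t), (y - (s + (a - s) * b)) * g y =
      (a - s) ^ 2 * ∫ u in (0 : ℝ)..t, (u - b) * g (s + (a - s) * u) := by
    have := intervalIntegral.mul_integral_comp_add_mul (a := 0) (b := t)
      (f := fun y => (y - (s + (a - s) * b)) * g y) (c := a - s) (d := s)
    rw [mul_zero, add_zero] at this
    rw [← this, sq, mul_assoc,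
      ← intervalIntegral.integral_const_mul (a - s) fun u => (u - b) * g (s + (a - s) * u)]
    congr 1
    refine intervalIntegral.integral_congr fun u _ => ?_
    ring
  have hpos : 0 < (a - s) ^ 2 := by positivity
  have hz := eqOn_zero_Icc_of_integral_mul_nonneg (h := fun u => g (s + (a - s) * u))
    (by fun_prop)
    (fun t => by
      have k := key 0 t
      have := h0 (s + (a - s) * t)
      simp only [mul_zero, add_zero, sub_zero] at k
      rw [k] at this
      exact nonneg_of_mul_nonneg_right this hpos)
    (fun t => by
      have k := key 1 t
      have := h1 (s + (a - s) * t)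
      simp only [mul_one, add_sub_cancel] at k
      rw [k] at this
      exact nonneg_of_mul_nonneg_right this hpos)
  constructor
  · simpa using hz (Set.left_mem_Icc.2 zero_le_one)
  · simpa using hz (Set.right_mem_Icc.2 zero_le_one)

/-- If `s` belongs to the set `E(s)` of levels `a` for which
`F_a(x) = ∫_a^x (y-a) g(y) dy` is globally minimized at `s`, and `E(s)` is not
the singleton `{s}`, then `g` vanishes on all of `E(s)`. -/
theorem stmt11 (g : ℝ → ℝ) (hg : Continuous g) (s : ℝ)
    (F : ℝ → ℝ → ℝ) (hF : ∀ a x : ℝ, F a x = ∫ y in a..x, (y - a) * g y)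
    (E : Set ℝ) (hE : E = {a : ℝ | ∀ x : ℝ, F a s ≤ F a x})
    (hs : s ∈ E) (hne : E ≠ {s}) :
    ∀ y ∈ E, g y = 0 := by
  have hint : ∀ a ∈ E, ∀ x : ℝ, 0 ≤ ∫ y in s..x, (y - a) * g y := by
    intro a ha x
    rw [hE] at ha
    have hc : Continuous fun y : ℝ => (y - a) * g y := by fun_prop
    have hx := ha x
    rw [hF, hF] at hx
    rw [← intervalIntegral.integral_interval_sub_left (hc.intervalIntegrable a x)
      (hc.intervalIntegrable a s)]
    exact sub_nonneg.2 hx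
  have hzero : ∀ a ∈ E, a ≠ s → g s = 0 ∧ g a = 0 := fun a ha has =>
    eq_zero_and_eq_zero_of_integral_sub_mul_nonneg hg has (hint s hs) (hint a ha)
  obtain ⟨b, hb, hbs⟩ : ∃ b ∈ E, b ≠ s := by
    by_contra! hcon
    exact hne (Set.eq_singleton_iff_unique_mem.2 ⟨hs, hcon⟩)
  intro y hy
  rcases eq_or_ne y s with rfl | hys
  · exact (hzero b hb hbs).1
  · exact (hzero y hy hys).2
end
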